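/- Let (b_{nj})_{j=0,…,n; n=1,2,…} be a triangular array of points in [0,1] with each row strictly increasing in j. Suppose there is a continuously differentiable function φ on [0,1] with φ' ≥ 0 whose zero set {x ∈ [0,1] : φ'(x) = 0} is finite, such that the normalized counting measures converge weak-* to φ'(x)dx: for every continuous function f : [0,1] → ℝ, (1/(n+1)) ∑_{j=0}^{n} f(b_{nj}) → ∫₀¹ f(x) φ'(x) dx as n → ∞. Then the array has Property (★). -/

import Mathlib

open Filter

/-- Midpoint of adjacent points in row `n` of a triangular array whose row `n`
consists of the `n+1` points `b n 0 < b n 1 < ⋯ < b n n`. -/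
noncomputable def mid (b : ℕ → ℕ → ℝ) (n j : ℕ) : ℝ := (b n j + b n (j + 1)) / 2

/-- Half-gap `s_n(j) = m_{nj} - b_{nj}`. -/
noncomputable def sgap (b : ℕ → ℕ → ℝ) (n j : ℕ) : ℝ := mid b n j - b n j

/-- `H_n(j) = ((1/(n+1)) ∑_{k=0}^{n} 1/|m_{nj} - b_{nk}|)⁻¹` (row `n` has
`N = n+1` points). -/
noncomputable def Hfun (b : ℕ → ℕ → ℝ) (n j : ℕ) : ℝ :=
  ((1 / ((n : ℝ) + 1)) * ∑ k ∈ Finset.range (n + 1), 1 / |mid b n j - b n k|)⁻¹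

/-- Property (★) for a triangular array with rows indexed `j = 0, …, n`:
the maximum of `s_n(j)/H_n(j)` over the `n` midpoints of row `n` tends to `0`. -/
def PropertyStar (b : ℕ → ℕ → ℝ) : Prop :=
  Tendsto (fun n : ℕ => ⨆ j ∈ Finset.range n, sgap b n j / Hfun b n j)
    atTop (nhds 0)

/-- If a density `g` is bounded by `M`, a function with values in `[0,1]` supported in a ball of
radius `r` has integral at most `2 r M` against `g`. -/
lemma integral_mul_le_of_support {f g : ℝ → ℝ} {c r M : ℝ} (hr : 0 ≤ r)
    (hf : ContinuousOn f (Set.Icc 0 1)) (hg : ContinuousOn g (Set.Icc 0 1))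
    (hf1 : ∀ x, f x ≤ 1) (hfs : ∀ x, r < |x - c| → f x = 0)
    (hg0 : ∀ x ∈ Set.Icc (0 : ℝ) 1, 0 ≤ g x) (hgM : ∀ x ∈ Set.Icc (0 : ℝ) 1, g x ≤ M) :
    ∫ x in (0 : ℝ)..1, f x * g x ≤ 2 * r * M := by
  have hM : 0 ≤ M := (hg0 0 (by simp)).trans (hgM 0 (by simp))
  set S : Set ℝ := Set.Icc (c - r) (c + r)
  have hS : MeasureTheory.Integrable (S.indicator fun _ => M) MeasureTheory.volume :=
    (MeasureTheory.integrable_indicator_iff measurableSet_Icc).2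
      (MeasureTheory.integrableOn_const (by simp) (by simp))
  have hS0 : ∀ x, 0 ≤ S.indicator (fun _ => M) x := Set.indicator_nonneg fun _ _ => hM
  calc ∫ x in (0 : ℝ)..1, f x * g x
      ≤ ∫ x in (0 : ℝ)..1, S.indicator (fun _ => M) x := by
        refine intervalIntegral.integral_mono_on zero_le_one
          ((hf.mul hg).intervalIntegrable_of_Icc zero_le_one) hS.intervalIntegrable fun x hx => ?_
        by_cases hxS : x ∈ S
        · rw [Set.indicator_of_mem hxS]
          nlinarith [hf1 x, hg0 x hx, hgM x hx]
        · rw [Set.indicator_of_notMem hxS, hfs x, zero_mul]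
          by_contra! h
          rw [abs_le] at h
          exact hxS ⟨by linarith, by linarith⟩
    _ ≤ ∫ x, S.indicator (fun _ => M) x := by
        rw [intervalIntegral.integral_of_le zero_le_one]
        exact MeasureTheory.setIntegral_le_integral hS (Eventually.of_forall hS0)
    _ = 2 * r * M := by
        rw [MeasureTheory.integral_indicator measurableSet_Icc, MeasureTheory.setIntegral_const,
          Real.volume_real_Icc_of_le (by linarith), smul_eq_mul]
        ring

/-- The trapezoidal function equal to `1` on the ball of radius `2 / K` about `c` and vanishing
outside the ball of radius `3 / K`. -/
noncomputable def plateau (c K x : ℝ) : ℝ := max 0 (min 1 (3 - K * |x - c|))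

lemma continuous_plateau (c K : ℝ) : Continuous (plateau c K) := by
  unfold plateau
  fun_prop

lemma plateau_nonneg (c K x : ℝ) : 0 ≤ plateau c K x := le_max_left _ _

lemma plateau_le_one (c K x : ℝ) : plateau c K x ≤ 1 :=
  max_le zero_le_one (min_le_left _ _)

lemma plateau_eq_one {c K x : ℝ} (h : K * |x - c| ≤ 2) : plateau c K x = 1 := by
  rw [plateau, min_eq_left (by linarith), max_eq_right zero_le_one]

lemma plateau_eq_zero {c K x : ℝ} (h : 3 ≤ K * |x - c|) : plateau c K x = 0 := by
  rw [plateau, max_eq_left]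
  exact (min_le_right _ _).trans (by linarith)

section Array

variable {b : ℕ → ℕ → ℝ} {g : ℝ → ℝ}

/-- Adjacent points become uniformly close when the limiting density vanishes at only finitely
many points. -/
lemma eventually_gap_le
    (hmem : ∀ n j, j ≤ n → b n j ∈ Set.Icc (0 : ℝ) 1)
    (hmono : ∀ n j k, j < k → k ≤ n → b n j < b n k)
    (hgcont : ContinuousOn g (Set.Icc 0 1))
    (hgnonneg : ∀ x ∈ Set.Icc (0 : ℝ) 1, 0 ≤ g x)
    (hgzero : {x ∈ Set.Icc (0 : ℝ) 1 | g x = 0}.Finite)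
    (hweak : ∀ f : ℝ → ℝ, ContinuousOn f (Set.Icc 0 1) →
      Tendsto (fun n : ℕ => (1 / ((n : ℝ) + 1)) * ∑ j ∈ Finset.range (n + 1), f (b n j))
        atTop (nhds (∫ x in (0 : ℝ)..1, f x * g x)))
    {K : ℕ} (hK : 0 < K) :
    ∀ᶠ n in atTop, ∀ j < n, b n (j + 1) - b n j ≤ 2 / K := by
  have hK' : (0 : ℝ) < K := by exact_mod_cast hK
  have key : ∀ i ∈ Finset.range K, ∀ᶠ n in atTop,
      ∃ k ≤ n, b n k ∈ Set.Ioo ((i : ℝ) / K) ((i + 1) / K) := by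
    intro i hi
    have hi' : (i : ℝ) + 1 ≤ K := by exact_mod_cast Finset.mem_range.1 hi
    have hi0 : (0 : ℝ) ≤ i / K := by positivity
    have hi1 : ((i : ℝ) + 1) / K ≤ 1 := (div_le_one hK').2 hi'
    have hlt : (i : ℝ) / K < (i + 1) / K := by gcongr; linarith
    set f : ℝ → ℝ := fun x => max 0 (min (x - i / K) ((i + 1) / K - x))
    have hf : Continuous f := by fun_prop
    have hf0 : ∀ x, 0 ≤ f x := fun x => le_max_left _ _
    have hpos : 0 < ∫ x in (0 : ℝ)..1, f x * g x := by
      obtain ⟨x, hx, hxz⟩ := ((Set.Ioo_infinite hlt).sdiff hgzero).nonempty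
      have hx01 : x ∈ Set.Icc (0 : ℝ) 1 := ⟨by linarith [hx.1], by linarith [hx.2]⟩
      refine intervalIntegral.integral_pos zero_lt_one (hf.continuousOn.mul hgcont)
        (fun y hy => mul_nonneg (hf0 y) (hgnonneg y ⟨hy.1.le, hy.2⟩)) ⟨x, hx01, mul_pos ?_ ?_⟩
      · exact lt_max_of_lt_right (lt_min (by linarith [hx.1]) (by linarith [hx.2]))
      · exact lt_of_le_of_ne (hgnonneg x hx01) fun h => hxz ⟨hx01, h.symm⟩
    filter_upwards [(hweak f hf.continuousOn).eventually_const_lt hpos] with n hn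
    have hsum : 0 < ∑ j ∈ Finset.range (n + 1), f (b n j) :=
      pos_of_mul_pos_right hn (by positivity)
    obtain ⟨k, hk, hfk⟩ := Finset.exists_lt_of_sum_lt (f := fun _ => (0 : ℝ)) (by simpa using hsum)
    refine ⟨k, Nat.lt_succ_iff.1 (Finset.mem_range.1 hk), ?_⟩
    rcases lt_max_iff.1 hfk with h | h
    · exact absurd h (lt_irrefl _)
    · have := lt_min_iff.1 h
      exact ⟨by linarith [this.1], by linarith [this.2]⟩
  filter_upwards [(Finset.eventually_all _).2 key] with n hn j hj
  by_contra! hgap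
  have h0 := (hmem n j hj.le).1
  have h1 := (hmem n (j + 1) hj).2
  set i := ⌊b n j * K⌋₊ + 1
  have hlow : b n j < (i : ℝ) / K := by
    rw [lt_div_iff₀ hK']
    exact_mod_cast Nat.lt_floor_add_one (b n j * K)
  have hhigh : ((i : ℝ) + 1) / K ≤ b n j + 2 / K := by
    rw [div_le_iff₀ hK', add_mul, div_mul_cancel₀ _ hK'.ne']
    have := Nat.floor_le (mul_nonneg h0 hK'.le)
    push_cast [i]
    linarith
  have hiK : i < K := by
    have : ((i : ℝ) + 1) / K < 1 := by linarith
    rw [div_lt_one hK'] at this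
    exact_mod_cast (lt_add_one (i : ℝ)).trans this
  obtain ⟨k, hk, hk1, hk2⟩ := hn i (Finset.mem_range.2 hiK)
  rcases lt_trichotomy k j with h | h | h
  · linarith [hmono n k j h hj.le]
  · subst h; linarith
  · rcases (Nat.succ_le_of_lt h).eq_or_lt with h | h
    · subst h; linarith
    · linarith [hmono n (j + 1) k h hk]

/-- The half-gap is a lower bound for the distance of the midpoint to every point of the row. -/
lemma sgap_le_abs (hmono : ∀ n j k, j < k → k ≤ n → b n j < b n k) {n j k : ℕ}
    (hj : j < n) (hk : k ≤ n) : sgap b n j ≤ |mid b n j - b n k| := by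
  unfold sgap mid
  rcases le_or_gt k j with h | h
  · have : b n k ≤ b n j := by
      rcases h.eq_or_lt with rfl | h
      exacts [le_rfl, (hmono n k j h hj.le).le]
    exact le_trans (by linarith) (le_abs_self _)
  · have : b n (j + 1) ≤ b n k := by
      rcases (Nat.succ_le_of_lt h).eq_or_lt with h | h
      · rw [← h]
      · exact (hmono n (j + 1) k h hk).le
    exact le_trans (by linarith) (neg_le_abs _)

lemma sgap_pos (hmono : ∀ n j k, j < k → k ≤ n → b n j < b n k) {n j : ℕ} (hj : j < n) :
    0 < sgap b n j := by
  unfold sgap mid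
  linarith [hmono n j (j + 1) j.lt_succ_self hj]

lemma sgap_div_Hfun_nonneg (hmono : ∀ n j k, j < k → k ≤ n → b n j < b n k) {n j : ℕ}
    (hj : j < n) : 0 ≤ sgap b n j / Hfun b n j := by
  have := sgap_pos hmono hj
  unfold Hfun
  positivity

/-- Points within `1 / K` of the midpoint contribute at most their proportion; the others
contribute at most `K` times the half-gap. -/
lemma sgap_div_Hfun_le (hmono : ∀ n j k, j < k → k ≤ n → b n j < b n k) {n j : ℕ} {c K : ℝ}
    (hj : j < n) (hK : 0 < K) (hc : K * |mid b n j - c| ≤ 1) :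
    sgap b n j / Hfun b n j ≤
      (1 / ((n : ℝ) + 1)) * ∑ k ∈ Finset.range (n + 1), plateau c K (b n k) + K * sgap b n j := by
  have hs := sgap_pos hmono hj
  have hterm : ∀ k ∈ Finset.range (n + 1), sgap b n j * (1 / |mid b n j - b n k|) ≤
      plateau c K (b n k) + K * sgap b n j := by
    intro k hk
    have hle := sgap_le_abs hmono hj (Nat.lt_succ_iff.1 (Finset.mem_range.1 hk))
    have hpos : 0 < |mid b n j - b n k| := hs.trans_le hle
    rw [mul_one_div]
    rcases le_or_gt (K * |mid b n j - b n k|) 1 with h | h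
    · have htri : |b n k - c| ≤ |mid b n j - b n k| + |mid b n j - c| := by
        rw [abs_sub_comm (mid b n j) (b n k)]
        exact abs_sub_le _ _ _
      rw [plateau_eq_one (by nlinarith)]
      have : sgap b n j / |mid b n j - b n k| ≤ 1 := (div_le_one hpos).2 hle
      nlinarith
    · have : sgap b n j / |mid b n j - b n k| ≤ K * sgap b n j := by
        rw [div_le_iff₀ hpos]
        nlinarith
      linarith [plateau_nonneg c K (b n k)]
  have hn : (0 : ℝ) < n + 1 := by positivity
  calc sgap b n j / Hfun b n j
      = (1 / ((n : ℝ) + 1)) *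
          ∑ k ∈ Finset.range (n + 1), sgap b n j * (1 / |mid b n j - b n k|) := by
        rw [Hfun, div_inv_eq_mul, ← Finset.mul_sum]
        ring
    _ ≤ (1 / ((n : ℝ) + 1)) *
          ∑ k ∈ Finset.range (n + 1), (plateau c K (b n k) + K * sgap b n j) := by
        gcongr with k hk
        exact hterm k hk
    _ = _ := by
        rw [Finset.sum_add_distrib, Finset.sum_const, Finset.card_range, nsmul_eq_mul]
        push_cast
        field_simp

end Array

/-- Corollary.  Let `(b_{nj})_{j=0,…,n}` be a triangular array
of points of `[0,1]` with strictly increasing rows.  Suppose there is a `C¹`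
function `φ` on `[0,1]` with derivative `φ' = g ≥ 0` whose zero set is finite,
such that the normalized counting measures of the rows converge weak-* to
`φ'(x)dx`: for every continuous `f` on `[0,1]`,
`(1/(n+1)) ∑_{j=0}^n f(b_{nj}) → ∫₀¹ f(x) φ'(x) dx`.  Then the array has
Property (★). -/
theorem stmt_8
    (b : ℕ → ℕ → ℝ)
    (hmem : ∀ n j, j ≤ n → b n j ∈ Set.Icc (0 : ℝ) 1)
    (hmono : ∀ n j k, j < k → k ≤ n → b n j < b n k)
    (φ g : ℝ → ℝ)
    (hderiv : ∀ x ∈ Set.Icc (0 : ℝ) 1, HasDerivWithinAt φ (g x) (Set.Icc 0 1) x)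
    (hgcont : ContinuousOn g (Set.Icc 0 1))
    (hgnonneg : ∀ x ∈ Set.Icc (0 : ℝ) 1, 0 ≤ g x)
    (hgzero : {x ∈ Set.Icc (0 : ℝ) 1 | g x = 0}.Finite)
    (hweak : ∀ f : ℝ → ℝ, ContinuousOn f (Set.Icc 0 1) →
      Tendsto (fun n : ℕ => (1 / ((n : ℝ) + 1)) * ∑ j ∈ Finset.range (n + 1), f (b n j))
        atTop (nhds (∫ x in (0 : ℝ)..1, f x * g x))) :
    PropertyStar b := by
  obtain ⟨M, hM⟩ := isCompact_Icc.bddAbove_image hgcont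
  have hgM : ∀ x ∈ Set.Icc (0 : ℝ) 1, g x ≤ M := fun x hx => hM ⟨x, hx, rfl⟩
  refine tendsto_order.2 ⟨fun a ha => ?_, fun ε hε => ?_⟩
  · refine Eventually.of_forall fun n => ha.trans_le ?_
    exact Real.iSup_nonneg fun j => Real.iSup_nonneg fun hj =>
      sgap_div_Hfun_nonneg hmono (Finset.mem_range.1 hj)
  obtain ⟨K, hK⟩ := exists_nat_gt (max 0 (6 * M / (ε / 4)))
  have hK0 : (0 : ℝ) < K := (le_max_left _ _).trans_lt hK
  have hKM : 2 * (3 / (K : ℝ)) * M < ε / 4 := by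
    have := (le_max_right _ _).trans_lt hK
    rw [div_lt_iff₀ (by positivity)] at this
    rw [show 2 * (3 / (K : ℝ)) * M = 6 * M / K by ring, div_lt_iff₀ hK0]
    linarith
  have hcount : ∀ i ∈ Finset.range (K + 1), ∀ᶠ n : ℕ in atTop,
      (1 / ((n : ℝ) + 1)) * ∑ k ∈ Finset.range (n + 1), plateau (i / K) K (b n k) < ε / 4 := by
    intro i _
    have hc := (continuous_plateau (i / K) K).continuousOn (s := Set.Icc 0 1)
    refine (hweak _ hc).eventually_lt_const (lt_of_le_of_lt ?_ hKM)
    refine integral_mul_le_of_support (c := i / K) (by positivity) hc hgcont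
      (plateau_le_one _ _) (fun x hx => plateau_eq_zero ?_) hgnonneg hgM
    rw [div_lt_iff₀ hK0] at hx
    linarith
  obtain ⟨L, hL⟩ := exists_nat_gt (max 0 (K / (ε / 4)))
  have hL0 : (0 : ℝ) < L := (le_max_left _ _).trans_lt hL
  have hKL : K * (1 / (L : ℝ)) < ε / 4 := by
    have := (le_max_right _ _).trans_lt hL
    rw [div_lt_iff₀ (by positivity)] at this
    rw [mul_one_div, div_lt_iff₀ hL0]
    linarith
  filter_upwards [(Finset.eventually_all _).2 hcount,
    eventually_gap_le hmem hmono hgcont hgnonneg hgzero hweak (K := L) (by exact_mod_cast hL0)]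
    with n hn hgap
  refine lt_of_le_of_lt (b := ε / 2) ?_ (by linarith)
  refine Real.iSup_le (fun j => Real.iSup_le (fun hj => ?_) (by positivity)) (by positivity)
  have hj := Finset.mem_range.1 hj
  have hm0 : 0 ≤ mid b n j := by
    unfold mid
    linarith [(hmem n j hj.le).1, (hmem n (j + 1) hj).1]
  have hm1 : mid b n j ≤ 1 := by
    unfold mid
    linarith [(hmem n j hj.le).2, (hmem n (j + 1) hj).2]
  set i := ⌊mid b n j * K⌋₊
  have hi : (i : ℝ) ≤ mid b n j * K := Nat.floor_le (by positivity)
  have hi' : mid b n j * K < i + 1 := Nat.lt_floor_add_one _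
  have hiK : i < K + 1 := by
    have : (i : ℝ) < K + 1 := by nlinarith
    exact_mod_cast this
  have hc : K * |mid b n j - i / K| ≤ 1 := by
    rw [← abs_of_pos hK0, ← abs_mul, abs_of_pos hK0, mul_sub, mul_div_cancel₀ _ hK0.ne', abs_le]
    constructor <;> linarith
  have hs : sgap b n j ≤ 1 / L := by
    have := hgap j hj
    rw [show (2 : ℝ) / L = 2 * (1 / L) by ring] at this
    unfold sgap mid
    linarith
  have := sgap_div_Hfun_le hmono hj hK0 hc
  have := hn i (Finset.mem_range.2 hiK)
  have := mul_le_mul_of_nonneg_left hs hK0.le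
  linarith
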